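/- Let t ≥ 1 be an integer, f(b,k,t) = ln( b^k (1-b)^{t-k} Γ(t+1) Γ(1/2)² / ( Γ(k + 1/2) Γ(t-k + 1/2) ) ), and h(b) = max_{k ∈ {0,…,t}} f(b,k,t). Then the sequence i ↦ h(i/t) is nonincreasing for i = 0, …, ⌈(t+1)/2⌉ - 1 and nondecreasing for i = t - (⌈(t+1)/2⌉ - 1), …, t. -/

import Mathlib

/-- The extended-real logarithm, with the convention `ln x = -∞` for `x ≤ 0`. -/
noncomputable def elog (x : ℝ) : EReal :=
  if x ≤ 0 then ⊥ else ((Real.log x : ℝ) : EReal)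

theorem elog_mono : Monotone elog := by
  intro x y hxy
  unfold elog
  split_ifs with hx hy hy
  · exact le_rfl
  · exact bot_le
  · exact absurd (hxy.trans hy) hx
  · exact EReal.coe_le_coe_iff.2 (Real.log_le_log (not_le.1 hx) hxy)

/-- The argument of the logarithm in `f(i/t, k, t)`. -/
noncomputable def regretTerm (t i k : ℕ) : ℝ :=
  ((i : ℝ) / t) ^ k * (1 - (i : ℝ) / t) ^ (t - k) *
      Real.Gamma (t + 1) * Real.Gamma (1 / 2) ^ 2 /
    (Real.Gamma (k + 1 / 2) * Real.Gamma ((t : ℝ) - k + 1 / 2))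

theorem gamma_half_pos (n : ℕ) : 0 < Real.Gamma (n + 1 / 2) :=
  Real.Gamma_pos_of_pos (by positivity)

theorem gamma_half_succ (n : ℕ) :
    Real.Gamma ((n + 1 : ℕ) + 1 / 2) = (n + 1 / 2) * Real.Gamma (n + 1 / 2) := by
  rw [← Real.Gamma_add_one (by positivity)]
  congr 1
  push_cast
  ring

theorem regretTerm_add {i m k l : ℕ} (h : i + m = k + l) (hpos : 0 < k + l) :
    regretTerm (k + l) i k =
      (i : ℝ) ^ k * (m : ℝ) ^ l / (Real.Gamma (k + 1 / 2) * Real.Gamma (l + 1 / 2)) *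
        (Real.Gamma ((k + l : ℕ) + 1) * Real.Gamma (1 / 2) ^ 2 / ((k + l : ℕ) : ℝ) ^ (k + l)) := by
  have ht : ((k + l : ℕ) : ℝ) ≠ 0 := by exact_mod_cast hpos.ne'
  have h1 : (1 : ℝ) - (i : ℝ) / (k + l : ℕ) = m / (k + l : ℕ) := by
    have : (i : ℝ) + m = (k + l : ℕ) := by exact_mod_cast h
    field_simp
    linarith
  have h2 : ((k + l : ℕ) : ℝ) - k = l := by push_cast; ring
  have hk := (gamma_half_pos k).ne'
  have hl := (gamma_half_pos l).ne'
  rw [regretTerm, h1, h2, Nat.add_sub_cancel_left, div_pow, div_pow, pow_add]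
  field_simp

theorem regretTerm_factor_nonneg (t : ℕ) :
    0 ≤ Real.Gamma ((t : ℕ) + 1) * Real.Gamma (1 / 2) ^ 2 / (t : ℝ) ^ t := by
  have := Real.Gamma_pos_of_pos (show (0 : ℝ) < t + 1 by positivity)
  positivity

theorem regretTerm_symm {t i k : ℕ} (ht : 1 ≤ t) (hi : i ≤ t) (hk : k ≤ t) :
    regretTerm t (t - i) (t - k) = regretTerm t i k := by
  obtain ⟨m, hm⟩ := Nat.exists_eq_add_of_le hi
  obtain ⟨l, rfl⟩ := Nat.exists_eq_add_of_le hk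
  rw [show k + l - i = m by omega, show k + l - k = l by omega,
    regretTerm_add hm.symm (by omega)]
  have h := regretTerm_add (i := m) (m := i) (k := l) (l := k) (by omega) (by omega)
  rw [add_comm l k] at h
  rw [h]
  ring

theorem regretTerm_succ_le {t i k : ℕ} (hi : i ≤ k) (hk : k + 1 ≤ t) :
    regretTerm t i (k + 1) ≤ regretTerm t i k := by
  obtain ⟨l, rfl⟩ := Nat.exists_eq_add_of_le hk
  obtain ⟨m, hm⟩ := Nat.exists_eq_add_of_le (show i ≤ k + 1 + l by omega)
  have h := regretTerm_add (i := i) (m := m) (k := k) (l := l + 1) (by omega) (by omega)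
  rw [show k + (l + 1) = k + 1 + l by omega] at h
  rw [regretTerm_add hm.symm (by omega), h]
  refine mul_le_mul_of_nonneg_right ?_ (regretTerm_factor_nonneg _)
  have uk := gamma_half_pos k
  have ul := gamma_half_pos l
  rw [gamma_half_succ, gamma_half_succ, div_le_div_iff₀ (by positivity) (by positivity),
    pow_succ, pow_succ]
  have key : (i : ℝ) * (l + 1 / 2) ≤ m * (k + 1 / 2) := by
    have e : (k : ℝ) + 1 + l = i + m := by exact_mod_cast hm
    have hi' : (i : ℝ) ≤ k := by exact_mod_cast hi
    have : (m : ℝ) = k + 1 + l - i := by linarith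
    rw [this]
    nlinarith [(Nat.cast_nonneg l : (0 : ℝ) ≤ l), (Nat.cast_nonneg k : (0 : ℝ) ≤ k)]
  have := mul_le_mul_of_nonneg_left key (show 0 ≤ (i : ℝ) ^ k * (m : ℝ) ^ l *
    (Real.Gamma (k + 1 / 2) * Real.Gamma (l + 1 / 2)) by positivity)
  linarith

theorem regretTerm_le_of_ge {t i k : ℕ} (hi : i ≤ k) (hk : k ≤ t) :
    regretTerm t i k ≤ regretTerm t i i := by
  induction k, hi using Nat.le_induction with
  | base => exact le_rfl
  | succ k hik ih => exact (regretTerm_succ_le hik hk).trans (ih (by omega))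

theorem regretTerm_le_diag {t i k : ℕ} (ht : 1 ≤ t) (hi : i ≤ t) (hk : k ≤ t) :
    regretTerm t i k ≤ regretTerm t i i := by
  rcases le_total i k with h | h
  · exact regretTerm_le_of_ge h hk
  · rw [← regretTerm_symm ht hi hk, ← regretTerm_symm ht hi hi]
    exact regretTerm_le_of_ge (by omega) (by omega)

theorem monotoneOn_mul_log_increment :
    MonotoneOn (fun x : ℝ => (x + 1) * Real.log (x + 1) - x * Real.log x - Real.log (x + 1 / 2))
      (Set.Ici 0) := by
  refine monotoneOn_of_hasDerivWithinAt_nonneg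
    (f' := fun x => (Real.log (x + 1) + 1) - (Real.log x + 1) - 1 / (x + 1 / 2))
    (convex_Ici 0) ?_ ?_ ?_
  · have h := Real.continuous_mul_log
    refine ContinuousOn.sub (Continuous.continuousOn ?_) ?_
    · exact (h.comp (continuous_id.add continuous_const)).sub h
    · refine ContinuousOn.log (by fun_prop) fun x hx => ?_
      have : (0 : ℝ) ≤ x := hx
      positivity
  · intro x hx
    rw [interior_Ici] at hx
    have hx0 : (0 : ℝ) < x := hx
    refine HasDerivAt.hasDerivWithinAt ?_
    have h1 : HasDerivAt (fun x : ℝ => (x + 1) * Real.log (x + 1)) (Real.log (x + 1) + 1) x :=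
      HasDerivAt.comp_add_const x 1 (Real.hasDerivAt_mul_log (by positivity))
    have h2 := Real.hasDerivAt_mul_log hx0.ne'
    have h3 : HasDerivAt (fun x : ℝ => Real.log (x + 1 / 2)) (1 / (x + 1 / 2)) x :=
      ((hasDerivAt_id x).add_const (1 / 2 : ℝ)).log (by simp only [id]; positivity)
    exact (h1.sub h2).sub h3
  · intro x hx
    rw [interior_Ici] at hx
    have hx0 : (0 : ℝ) < x := hx
    have h := Real.le_log_one_add_of_nonneg (x := 1 / x) (by positivity)
    rw [show 1 + 1 / x = (x + 1) / x by field_simp,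
      Real.log_div (by positivity) hx0.ne',
      show 2 * (1 / x) / (1 / x + 2) = 1 / (x + 1 / 2) by field_simp; ring] at h
    linarith

theorem pow_self_mul_gamma_half_le {i m : ℕ} (h : i ≤ m) :
    ((i + 1 : ℕ) : ℝ) ^ (i + 1) * (m : ℝ) ^ m /
        (Real.Gamma ((i + 1 : ℕ) + 1 / 2) * Real.Gamma (m + 1 / 2)) ≤
      (i : ℝ) ^ i * ((m + 1 : ℕ) : ℝ) ^ (m + 1) /
        (Real.Gamma (i + 1 / 2) * Real.Gamma ((m + 1 : ℕ) + 1 / 2)) := by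
  have pos (n : ℕ) : (0 : ℝ) < (n : ℝ) ^ n := by
    rcases n.eq_zero_or_pos with rfl | hn
    · simp
    · have : (0 : ℝ) < n := by exact_mod_cast hn
      positivity
  have ui := gamma_half_pos i
  have um := gamma_half_pos m
  rw [gamma_half_succ, gamma_half_succ]
  have p1 := pos i
  have p2 := pos m
  have p3 := pos (i + 1)
  have p4 := pos (m + 1)
  have key := monotoneOn_mul_log_increment (Set.mem_Ici.2 (Nat.cast_nonneg i))
    (Set.mem_Ici.2 (Nat.cast_nonneg m)) (Nat.cast_le.2 h : (i : ℝ) ≤ m)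
  have hi2 : (0 : ℝ) < i + 1 / 2 := by positivity
  have hm2 : (0 : ℝ) < m + 1 / 2 := by positivity
  rw [← Real.log_le_log_iff (by positivity) (by positivity),
    Real.log_div (by positivity) (by positivity), Real.log_div (by positivity) (by positivity),
    Real.log_mul p3.ne' p2.ne', Real.log_mul p1.ne' p4.ne',
    Real.log_mul (by positivity) um.ne', Real.log_mul ui.ne' (by positivity),
    Real.log_mul hi2.ne' ui.ne', Real.log_mul hm2.ne' um.ne']
  simp only [Real.log_pow]
  push_cast
  linarith

theorem regretTerm_diag_succ_le {t i : ℕ} (h : 2 * (i + 1) ≤ t) :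
    regretTerm t (i + 1) (i + 1) ≤ regretTerm t i i := by
  obtain ⟨m, rfl⟩ := Nat.exists_eq_add_of_le (show i + 1 ≤ t by omega)
  have e := regretTerm_add (i := i) (m := m + 1) (k := i) (l := m + 1) rfl (by omega)
  rw [show i + (m + 1) = i + 1 + m by omega] at e
  rw [regretTerm_add (m := m) rfl (by omega), e]
  exact mul_le_mul_of_nonneg_right (pow_self_mul_gamma_half_le (by omega))
    (regretTerm_factor_nonneg _)

theorem regretTerm_diag_antitone {t i j : ℕ} (hij : i ≤ j) (hj : 2 * j ≤ t) :
    regretTerm t j j ≤ regretTerm t i i := by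
  induction j, hij using Nat.le_induction with
  | base => exact le_rfl
  | succ j _ ih => exact (regretTerm_diag_succ_le hj).trans (ih (by omega))

theorem sup_elog_regretTerm {t i : ℕ} (ht : 1 ≤ t) (hi : i ≤ t) :
    (Finset.range (t + 1)).sup (fun k => elog (regretTerm t i k)) = elog (regretTerm t i i) := by
  refine le_antisymm (Finset.sup_le fun k hk => elog_mono (regretTerm_le_diag ht hi ?_)) ?_
  · exact Nat.lt_succ_iff.1 (Finset.mem_range.1 hk)
  · exact Finset.le_sup (f := fun k => elog (regretTerm t i k))
      (Finset.mem_range.2 (Nat.lt_succ_of_le hi))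

theorem two_mul_ceil_half_sub_one_le (t : ℕ) : 2 * (⌈((t : ℝ) + 1) / 2⌉₊ - 1) ≤ t := by
  have h : ⌈((t : ℝ) + 1) / 2⌉₊ ≤ t / 2 + 1 := by
    refine Nat.ceil_le.2 ?_
    have : (t : ℝ) + 1 ≤ 2 * (t / 2 + 1 : ℕ) := by
      exact_mod_cast (by omega : t + 1 ≤ 2 * (t / 2 + 1))
    linarith
  omega

/-- For `t ≥ 1`, let
`f(b,k,t) = ln( b^k (1-b)^{t-k} Γ(t+1) Γ(1/2)² / (Γ(k+1/2) Γ(t-k+1/2)) )`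
and `h(b) = max_{0 ≤ k ≤ t} f(b,k,t)`.  Then `i ↦ h(i/t)` is nonincreasing
for `i = 0,…,⌈(t+1)/2⌉ - 1` and nondecreasing for
`i = t - (⌈(t+1)/2⌉ - 1),…,t`. -/
theorem regret_bound_local_maxima_monotone (t : ℕ) (ht : 1 ≤ t) :
    (∀ i j : ℕ, i ≤ j → j ≤ ⌈((t : ℝ) + 1) / 2⌉₊ - 1 →
      (Finset.range (t + 1)).sup (fun k =>
          elog (((j : ℝ) / t) ^ k * (1 - (j : ℝ) / t) ^ (t - k) *
              Real.Gamma (t + 1) * Real.Gamma (1 / 2) ^ 2 /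
            (Real.Gamma (k + 1 / 2) * Real.Gamma ((t : ℝ) - k + 1 / 2))))
        ≤ (Finset.range (t + 1)).sup (fun k =>
            elog (((i : ℝ) / t) ^ k * (1 - (i : ℝ) / t) ^ (t - k) *
                Real.Gamma (t + 1) * Real.Gamma (1 / 2) ^ 2 /
              (Real.Gamma (k + 1 / 2) * Real.Gamma ((t : ℝ) - k + 1 / 2))))) ∧
    (∀ i j : ℕ, t - (⌈((t : ℝ) + 1) / 2⌉₊ - 1) ≤ i → i ≤ j → j ≤ t →
      (Finset.range (t + 1)).sup (fun k =>
          elog (((i : ℝ) / t) ^ k * (1 - (i : ℝ) / t) ^ (t - k) *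
              Real.Gamma (t + 1) * Real.Gamma (1 / 2) ^ 2 /
            (Real.Gamma (k + 1 / 2) * Real.Gamma ((t : ℝ) - k + 1 / 2))))
        ≤ (Finset.range (t + 1)).sup (fun k =>
            elog (((j : ℝ) / t) ^ k * (1 - (j : ℝ) / t) ^ (t - k) *
                Real.Gamma (t + 1) * Real.Gamma (1 / 2) ^ 2 /
              (Real.Gamma (k + 1 / 2) * Real.Gamma ((t : ℝ) - k + 1 / 2))))) := by
  have hc := two_mul_ceil_half_sub_one_le t
  constructor
  · intro i j hij hj
    have h := elog_mono (regretTerm_diag_antitone (t := t) hij (by omega))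
    rwa [← sup_elog_regretTerm ht (by omega), ← sup_elog_regretTerm ht (by omega)] at h
  · intro i j hi hij hj
    have h := elog_mono
      (regretTerm_diag_antitone (t := t) (i := t - j) (j := t - i) (by omega) (by omega))
    rwa [regretTerm_symm ht (by omega) (by omega), regretTerm_symm ht (by omega) (by omega),
      ← sup_elog_regretTerm ht (by omega), ← sup_elog_regretTerm ht (by omega)] at h
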